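/- Let α ≥ 2 and κ ≥ 1 be real numbers. Then the function g(x) = ln(1 + 1/(x + κ − 1)) − α/x is strictly monotone increasing on the interval [1, ∞). -/

import Mathlib

/-- For `α ≥ 2` and `κ ≥ 1`, the function `g(x) = ln(1 + 1/(x + κ - 1)) - α/x` is
strictly monotone increasing on `[1, ∞)` (key step in the proof of Theorem 1). -/
theorem strictMonoOn_log_sub_div
    (α κ : ℝ) (hα : 2 ≤ α) (hκ : 1 ≤ κ) :
    StrictMonoOn (fun x : ℝ => Real.log (1 + 1 / (x + κ - 1)) - α / x) (Set.Ici 1) := by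
  intro a ha b _ hab
  have ha0 : 0 < a := lt_of_lt_of_le one_pos ha
  have hb0 : 0 < b := ha0.trans hab
  have hu : 0 < a + κ - 1 := by linarith
  have hv : 0 < b + κ - 1 := by linarith
  have hlog : Real.log (1 + 1 / (a + κ - 1)) - Real.log (1 + 1 / (b + κ - 1)) ≤
      (b - a) / ((a + κ - 1) * (b + κ)) := by
    rw [← Real.log_div (by positivity) (by positivity)]
    refine (Real.log_le_sub_one_of_pos (by positivity)).trans_eq ?_
    have hw : b + κ ≠ 0 := by linarith
    have hw' : 1 + 1 / (b + κ - 1) = (b + κ) / (b + κ - 1) := by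
      field_simp
      ring
    rw [hw']
    field_simp
    ring
  have hfrac : (b - a) / ((a + κ - 1) * (b + κ)) ≤ (b - a) / (a * b) := by
    have hba : 0 ≤ b - a := by linarith
    gcongr <;> linarith
  have hpos : 0 < (b - a) / (a * b) := div_pos (by linarith) (by positivity)
  have hdiff : α / a - α / b = α * ((b - a) / (a * b)) := by
    field_simp
  have hmul : 2 * ((b - a) / (a * b)) ≤ α * ((b - a) / (a * b)) := by gcongr
  show Real.log (1 + 1 / (a + κ - 1)) - α / a < Real.log (1 + 1 / (b + κ - 1)) - α / b
  linarith
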